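/- arXiv:2412.16353 — 6 statements merged into one kernel-verified Lean document; each statement's English description precedes it below -/
import Mathlib

section
/- Fix g > 0 and B ∈ ℝ^K. The entropy E is Fréchet differentiable at every state U = (h, qˣ, qʸ) with 𝒫(h) invertible, and its derivative in the direction (δh, δqˣ, δqʸ) equals (−½𝒫(u)u − ½𝒫(v)v + g(h+B))·δh + u·δqˣ + v·δqʸ; equivalently the gradient of E at U is the entropy variable V(U) = (−½𝒫(u)u − ½𝒫(v)v + g(h+B), u, v) ∈ ℝ^{3K}. -/
open Matrix

/-- The Galerkin triple-product matrix `𝒫(a)`, defined by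
`(𝒫(a))_{l,m} = ∑ k, a k * T k l m`. -/
noncomputable def Pmat {K : ℕ} (T : Fin K → Fin K → Fin K → ℝ) (a : Fin K → ℝ) :
    Matrix (Fin K) (Fin K) ℝ :=
  Matrix.of fun l m => ∑ k, a k * T k l m

/-- A state `U = (h, qˣ, qʸ) ∈ ℝ^K × ℝ^K × ℝ^K`. -/
abbrev StateK (K : ℕ) := (Fin K → ℝ) × (Fin K → ℝ) × (Fin K → ℝ)

/-- The entropy `E(U) = ½(qˣ·u + qʸ·v) + ½g‖h‖² + g h·B`, with
`u = 𝒫(h)⁻¹qˣ` and `v = 𝒫(h)⁻¹qʸ`. -/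
noncomputable def entropyE {K : ℕ} (T : Fin K → Fin K → Fin K → ℝ) (g : ℝ)
    (B : Fin K → ℝ) (U : StateK K) : ℝ :=
  (1 / 2) * (U.2.1 ⬝ᵥ ((Pmat T U.1)⁻¹ *ᵥ U.2.1) + U.2.2 ⬝ᵥ ((Pmat T U.1)⁻¹ *ᵥ U.2.2))
    + (1 / 2) * g * (U.1 ⬝ᵥ U.1) + g * (U.1 ⬝ᵥ B)

/-- `x ↦ 𝒫(x)` is continuous. -/
theorem continuous_Pmat {K : ℕ} (T : Fin K → Fin K → Fin K → ℝ) : Continuous (Pmat T) :=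
  continuous_matrix fun l m => by
    simp only [Pmat, Matrix.of_apply]
    fun_prop

theorem Pmat_transpose {K : ℕ} {T : Fin K → Fin K → Fin K → ℝ}
    (hT : ∀ k l m, T k l m = T k m l) (a : Fin K → ℝ) : (Pmat T a)ᵀ = Pmat T a := by
  ext l m
  simp only [Pmat, Matrix.transpose_apply, Matrix.of_apply]
  exact Finset.sum_congr rfl fun k _ => by rw [hT]

/-- The symmetry `𝒫(a)b = 𝒫(b)a`. -/
theorem Pmat_mulVec_comm {K : ℕ} {T : Fin K → Fin K → Fin K → ℝ}
    (hT1 : ∀ k l m, T k l m = T l k m) (hT2 : ∀ k l m, T k l m = T k m l)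
    (a b : Fin K → ℝ) : Pmat T a *ᵥ b = Pmat T b *ᵥ a := by
  ext l
  simp only [Matrix.mulVec, dotProduct, Pmat, Matrix.of_apply, Finset.sum_mul]
  rw [Finset.sum_comm]
  refine Finset.sum_congr rfl fun k _ => Finset.sum_congr rfl fun m _ => ?_
  rw [hT2 k l m, hT1 k m l, hT2 m k l]
  ring

theorem dotProduct_Pmat_mulVec_self {K : ℕ} {T : Fin K → Fin K → Fin K → ℝ}
    (hT1 : ∀ k l m, T k l m = T l k m) (hT2 : ∀ k l m, T k l m = T k m l)
    (a u : Fin K → ℝ) : u ⬝ᵥ (Pmat T a *ᵥ u) = (Pmat T u *ᵥ u) ⬝ᵥ a := by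
  rw [Pmat_mulVec_comm hT1 hT2 a u, Matrix.dotProduct_mulVec, ← Matrix.mulVec_transpose,
    Pmat_transpose hT2]

/-- Completing the square in `q ⬝ᵥ M⁻¹ q` for a symmetric invertible matrix `M`. -/
theorem dotProduct_inv_mulVec_eq {n : Type*} [Fintype n] [DecidableEq n] {M : Matrix n n ℝ}
    (hM : IsUnit M) (hMt : Mᵀ = M) (q u : n → ℝ) :
    q ⬝ᵥ (M⁻¹ *ᵥ q) =
      2 * (u ⬝ᵥ q) - u ⬝ᵥ (M *ᵥ u) + (q - M *ᵥ u) ⬝ᵥ (M⁻¹ *ᵥ (q - M *ᵥ u)) := by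
  have hdet := (Matrix.isUnit_iff_isUnit_det M).mp hM
  have h1 : M⁻¹ *ᵥ (M *ᵥ u) = u := by
    rw [Matrix.mulVec_mulVec, Matrix.nonsing_inv_mul _ hdet, Matrix.one_mulVec]
  have h2 : (M *ᵥ u) ⬝ᵥ (M⁻¹ *ᵥ q) = u ⬝ᵥ q := by
    rw [← Matrix.vecMul_transpose, hMt, ← Matrix.dotProduct_mulVec, Matrix.mulVec_mulVec,
      Matrix.mul_nonsing_inv _ hdet, Matrix.one_mulVec]
  rw [Matrix.mulVec_sub, h1, sub_dotProduct, dotProduct_sub, dotProduct_sub, h2,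
    dotProduct_comm q u, dotProduct_comm (M *ᵥ u) u]
  ring

/-- A dot product of a differentiable and a continuous map, both vanishing at `x`, has zero
derivative at `x`. -/
theorem hasFDerivAt_dotProduct_zero {E n : Type*} [NormedAddCommGroup E] [NormedSpace ℝ E]
    [Fintype n] {r w : E → n → ℝ} {x : E} (hr : DifferentiableAt ℝ r x) (hrx : r x = 0)
    (hw : ContinuousAt w x) (hwx : w x = 0) :
    HasFDerivAt (fun y => r y ⬝ᵥ w y) (0 : E →L[ℝ] ℝ) x := by
  rw [hasFDerivAt_iff_isLittleO]
  have hi : ∀ i ∈ Finset.univ, (fun y => r y i * w y i) =o[nhds x] fun y => y - x := fun i _ => by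
    have h1 : (fun y => r y i) =O[nhds x] fun y => y - x := by
      simpa [hrx] using (differentiableAt_pi.mp hr i).isBigO_sub
    have h2 : (fun y => w y i) =o[nhds x] fun _ => (1 : ℝ) := by
      rw [Asymptotics.isLittleO_one_iff]
      simpa [hwx] using (continuousAt_pi.mp hw i).tendsto
    simpa using (h1.norm_right.mul_isLittleO h2).norm_right
  simpa [hrx, dotProduct] using Asymptotics.IsLittleO.fun_sum hi

/-- The derivative of `x ↦ q(x) ⬝ᵥ 𝒫(h(x))⁻¹ q(x)` for continuous linear maps `h` and `q`. -/
theorem hasFDerivAt_dotProduct_Pmat_inv {E : Type*} [NormedAddCommGroup E] [NormedSpace ℝ E]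
    {K : ℕ} {T : Fin K → Fin K → Fin K → ℝ}
    (hT1 : ∀ k l m, T k l m = T l k m) (hT2 : ∀ k l m, T k l m = T k m l)
    (h q : E →L[ℝ] (Fin K → ℝ)) {x : E} (hinv : IsUnit (Pmat T (h x))) {u : Fin K → ℝ}
    (hu : (Pmat T (h x))⁻¹ *ᵥ q x = u) {L : E →L[ℝ] ℝ}
    (hL : ∀ δ, L δ = 2 * (u ⬝ᵥ q δ) - (Pmat T u *ᵥ u) ⬝ᵥ h δ) :
    HasFDerivAt (fun y => q y ⬝ᵥ ((Pmat T (h y))⁻¹ *ᵥ q y)) L x := by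
  have hPc : Continuous fun y => Pmat T (h y) := (continuous_Pmat T).comp h.continuous
  have hdet := (Matrix.isUnit_iff_isUnit_det _).mp hinv
  have hr0 : q x - Pmat T u *ᵥ h x = 0 := by
    rw [Pmat_mulVec_comm hT1 hT2, ← hu, Matrix.mulVec_mulVec, Matrix.mul_nonsing_inv _ hdet,
      Matrix.one_mulVec, sub_self]
  have hr : Differentiable ℝ fun y => q y - Pmat T u *ᵥ h y :=
    q.differentiable.sub
      ((LinearMap.toContinuousLinearMap (Pmat T u).mulVecLin).differentiable.comp h.differentiable)
  have hinvc : ContinuousAt (fun y => (Pmat T (h y))⁻¹) x := by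
    refine ContinuousAt.comp (g := fun M : Matrix (Fin K) (Fin K) ℝ => M⁻¹)
      (continuousAt_matrix_inv _ ?_) hPc.continuousAt
    rw [Ring.inverse_eq_inv']
    exact continuousAt_inv₀ hdet.ne_zero
  have hw : ContinuousAt (fun y => (Pmat T (h y))⁻¹ *ᵥ (q y - Pmat T u *ᵥ h y)) x :=
    (Continuous.matrix_mulVec continuous_fst continuous_snd).continuousAt.comp
      (hinvc.prodMk hr.continuous.continuousAt)
  have key := L.hasFDerivAt.add
    (hasFDerivAt_dotProduct_zero (hr x) hr0 hw (by rw [hr0, Matrix.mulVec_zero]))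
  rw [add_zero] at key
  refine key.congr_of_eventuallyEq ?_
  filter_upwards [hPc.matrix_det.continuousAt.eventually_ne hdet.ne_zero] with y hy
  have hy' : IsUnit (Pmat T (h y)) := (Matrix.isUnit_iff_isUnit_det _).mpr hy.isUnit
  rw [dotProduct_inv_mulVec_eq hy' (Pmat_transpose hT2 _) (q y) u,
    dotProduct_Pmat_mulVec_self hT1 hT2, Pmat_mulVec_comm hT1 hT2 (h y) u]
  simp [hL]

/-- The linear functional `a ↦ w ⬝ᵥ a` as a continuous linear map. -/
noncomputable def dotProductCLM {n : Type*} [Fintype n] (w : n → ℝ) : (n → ℝ) →L[ℝ] ℝ :=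
  LinearMap.toContinuousLinearMap (dotProductBilin ℝ ℝ w)

@[simp]
theorem dotProductCLM_apply {n : Type*} [Fintype n] (w a : n → ℝ) :
    dotProductCLM w a = w ⬝ᵥ a := rfl

theorem hasFDerivAt_dotProduct_self {n : Type*} [Fintype n] (a : n → ℝ) :
    HasFDerivAt (fun y : n → ℝ => y ⬝ᵥ y) ((2 : ℝ) • dotProductCLM a) a := by
  have h0 := hasFDerivAt_dotProduct_zero (r := fun y => y - a) (w := fun y => y - a) (x := a)
    (by fun_prop) (sub_self a) (by fun_prop) (sub_self a)
  have key := (((2 : ℝ) • dotProductCLM a).hasFDerivAt (x := a)).add h0 |>.sub_const (a ⬝ᵥ a)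
  rw [add_zero] at key
  refine key.congr_of_eventuallyEq (Filter.Eventually.of_forall fun y => ?_)
  simp [sub_dotProduct, dotProduct_sub, dotProduct_comm y a]
  ring

/-- the entropy `E` is Fréchet differentiable at each state with `𝒫(h)`
invertible, with directional derivative
`(−½𝒫(u)u − ½𝒫(v)v + g(h+B))·δh + u·δqˣ + v·δqʸ`; that is, the gradient is the
entropy variable `V(U)`. -/
theorem entropy_hasFDerivAt {K : ℕ} (hK : 1 ≤ K) (T : Fin K → Fin K → Fin K → ℝ)
    (hT1 : ∀ k l m, T k l m = T l k m) (hT2 : ∀ k l m, T k l m = T k m l)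
    (g : ℝ) (hg : 0 < g) (B : Fin K → ℝ)
    (h qx qy : Fin K → ℝ) (hinv : IsUnit (Pmat T h)) :
    ∃ L : StateK K →L[ℝ] ℝ,
      HasFDerivAt (entropyE T g B) L (h, qx, qy) ∧
      ∀ δ : StateK K,
        L δ = (-(1 / 2 : ℝ) • (Pmat T ((Pmat T h)⁻¹ *ᵥ qx) *ᵥ ((Pmat T h)⁻¹ *ᵥ qx))
                - (1 / 2 : ℝ) • (Pmat T ((Pmat T h)⁻¹ *ᵥ qy) *ᵥ ((Pmat T h)⁻¹ *ᵥ qy))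
                + g • (h + B)) ⬝ᵥ δ.1
              + ((Pmat T h)⁻¹ *ᵥ qx) ⬝ᵥ δ.2.1
              + ((Pmat T h)⁻¹ *ᵥ qy) ⬝ᵥ δ.2.2 := by
  set u := (Pmat T h)⁻¹ *ᵥ qx with hu
  set v := (Pmat T h)⁻¹ *ᵥ qy with hv
  let πh : StateK K →L[ℝ] (Fin K → ℝ) := ContinuousLinearMap.fst ℝ _ _
  let πx : StateK K →L[ℝ] (Fin K → ℝ) :=
    (ContinuousLinearMap.fst ℝ _ _).comp (ContinuousLinearMap.snd ℝ _ _)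
  let πy : StateK K →L[ℝ] (Fin K → ℝ) :=
    (ContinuousLinearMap.snd ℝ _ _).comp (ContinuousLinearMap.snd ℝ _ _)
  have hx := hasFDerivAt_dotProduct_Pmat_inv hT1 hT2 πh πx (x := (h, qx, qy)) hinv hu.symm
    (L := (2 : ℝ) • (dotProductCLM u).comp πx - (dotProductCLM (Pmat T u *ᵥ u)).comp πh)
    fun δ => by simp
  have hy := hasFDerivAt_dotProduct_Pmat_inv hT1 hT2 πh πy (x := (h, qx, qy)) hinv hv.symm
    (L := (2 : ℝ) • (dotProductCLM v).comp πy - (dotProductCLM (Pmat T v *ᵥ v)).comp πh)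
    fun δ => by simp
  have hh : HasFDerivAt (fun U : StateK K => U.1 ⬝ᵥ U.1)
      (((2 : ℝ) • dotProductCLM h).comp πh) (h, qx, qy) :=
    HasFDerivAt.comp (g := fun y : Fin K → ℝ => y ⬝ᵥ y) (f := πh) (h, qx, qy)
      (hasFDerivAt_dotProduct_self h) πh.hasFDerivAt
  have hB : HasFDerivAt (fun U : StateK K => U.1 ⬝ᵥ B)
      ((dotProductCLM B).comp πh) (h, qx, qy) := by
    simp only [dotProduct_comm _ B]
    exact ((dotProductCLM B).comp πh).hasFDerivAt
  refine ⟨_, (((hx.add hy).const_mul (1 / 2)).add (hh.const_mul (1 / 2 * g))).add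
    (hB.const_mul g), fun δ => ?_⟩
  simp [πh, πx, πy, add_dotProduct, sub_dotProduct]
  ring
end

section
/- Fix g > 0 and B ∈ ℝ^K. The set D = {(h, qˣ, qʸ) ∈ ℝ^K × ℝ^K × ℝ^K : 𝒫(h) is positive definite} is convex, and the entropy E(U) = ½(qˣ·u + qʸ·v) + ½g‖h‖² + g h·B (with u = 𝒫(h)⁻¹qˣ, v = 𝒫(h)⁻¹qʸ) is strictly convex on D. -/
open Matrix

theorem Pmat_combo {K : ℕ} (T : Fin K → Fin K → Fin K → ℝ) (s t : ℝ) (a b : Fin K → ℝ) :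
    Pmat T (s • a + t • b) = s • Pmat T a + t • Pmat T b := by
  ext l m
  simp only [Pmat, Matrix.of_apply, Matrix.add_apply, Matrix.smul_apply, Pi.add_apply,
    Pi.smul_apply, smul_eq_mul, Finset.mul_sum, ← Finset.sum_add_distrib]
  exact Finset.sum_congr rfl fun k _ => by ring

/-- Completing the square for the quadratic form of the inverse of a positive definite matrix. -/
theorem Matrix.PosDef.dotProduct_inv_sub_eq {n : Type*} [Fintype n] [DecidableEq n]
    {A : Matrix n n ℝ} (hA : A.PosDef) (q w : n → ℝ) :
    q ⬝ᵥ (A⁻¹ *ᵥ q) - (2 * (q ⬝ᵥ w) - w ⬝ᵥ (A *ᵥ w))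
      = (w - A⁻¹ *ᵥ q) ⬝ᵥ (A *ᵥ (w - A⁻¹ *ᵥ q)) := by
  have hdet : IsUnit A.det := (Matrix.isUnit_iff_isUnit_det A).1 hA.isUnit
  have hinv : A *ᵥ (A⁻¹ *ᵥ q) = q := by
    rw [Matrix.mulVec_mulVec, Matrix.mul_nonsing_inv _ hdet, Matrix.one_mulVec]
  have hsymm : (A⁻¹ *ᵥ q) ⬝ᵥ (A *ᵥ w) = q ⬝ᵥ w := by
    have hAt : Aᵀ = A := by simpa using hA.isHermitian.eq
    rw [Matrix.dotProduct_mulVec, ← Matrix.mulVec_transpose, hAt, hinv]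
  rw [Matrix.mulVec_sub, hinv, sub_dotProduct, dotProduct_sub, dotProduct_sub, hsymm,
    dotProduct_comm w q, dotProduct_comm (A⁻¹ *ᵥ q) q]
  ring

theorem Matrix.PosDef.two_mul_dotProduct_sub_le {n : Type*} [Fintype n] [DecidableEq n]
    {A : Matrix n n ℝ} (hA : A.PosDef) (q w : n → ℝ) :
    2 * (q ⬝ᵥ w) - w ⬝ᵥ (A *ᵥ w) ≤ q ⬝ᵥ (A⁻¹ *ᵥ q) := by
  have h := hA.posSemidef.dotProduct_mulVec_nonneg (w - A⁻¹ *ᵥ q)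
  rw [star_trivial, ← hA.dotProduct_inv_sub_eq] at h
  linarith

theorem Matrix.PosDef.two_mul_dotProduct_sub_lt {n : Type*} [Fintype n] [DecidableEq n]
    {A : Matrix n n ℝ} (hA : A.PosDef) {q w : n → ℝ} (hw : A *ᵥ w ≠ q) :
    2 * (q ⬝ᵥ w) - w ⬝ᵥ (A *ᵥ w) < q ⬝ᵥ (A⁻¹ *ᵥ q) := by
  have hdet : IsUnit A.det := (Matrix.isUnit_iff_isUnit_det A).1 hA.isUnit
  have hne : w - A⁻¹ *ᵥ q ≠ 0 := by
    intro h
    apply hw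
    rw [sub_eq_zero.1 h, Matrix.mulVec_mulVec, Matrix.mul_nonsing_inv _ hdet, Matrix.one_mulVec]
  have h := hA.dotProduct_mulVec_pos hne
  rw [star_trivial, ← hA.dotProduct_inv_sub_eq] at h
  linarith

theorem Matrix.PosDef.combo {n : Type*} {A₁ A₂ : Matrix n n ℝ} (h₁ : A₁.PosDef)
    (h₂ : A₂.PosDef) {s t : ℝ} (hs : 0 ≤ s) (ht : 0 ≤ t) (hst : s + t = 1) :
    (s • A₁ + t • A₂).PosDef := by
  rcases hs.eq_or_lt with rfl | hs
  · obtain rfl : t = 1 := by linarith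
    simpa using h₂
  · exact (h₁.smul hs).add_posSemidef (h₂.posSemidef.smul ht)

/-- At the minimiser for the combined data, the quadratic form of the inverse is an average of the
variational lower bounds. -/
theorem Matrix.PosDef.exists_combo_dotProduct_inv_eq {n : Type*} [Fintype n] [DecidableEq n]
    {A₁ A₂ : Matrix n n ℝ} {s t : ℝ} (hA : (s • A₁ + t • A₂).PosDef) (q₁ q₂ : n → ℝ) :
    ∃ w, (s • q₁ + t • q₂) ⬝ᵥ ((s • A₁ + t • A₂)⁻¹ *ᵥ (s • q₁ + t • q₂))
      = s * (2 * (q₁ ⬝ᵥ w) - w ⬝ᵥ (A₁ *ᵥ w)) + t * (2 * (q₂ ⬝ᵥ w) - w ⬝ᵥ (A₂ *ᵥ w)) := by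
  refine ⟨(s • A₁ + t • A₂)⁻¹ *ᵥ (s • q₁ + t • q₂), ?_⟩
  have h := hA.dotProduct_inv_sub_eq (s • q₁ + t • q₂)
    ((s • A₁ + t • A₂)⁻¹ *ᵥ (s • q₁ + t • q₂))
  rw [sub_self, zero_dotProduct] at h
  rw [sub_eq_zero.1 h]
  generalize (s • A₁ + t • A₂)⁻¹ *ᵥ (s • q₁ + t • q₂) = w
  simp only [Matrix.add_mulVec, Matrix.smul_mulVec, add_dotProduct, dotProduct_add,
    smul_dotProduct, dotProduct_smul, smul_eq_mul]
  ring

theorem Matrix.PosDef.combo_dotProduct_inv_le {n : Type*} [Fintype n] [DecidableEq n]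
    {A₁ A₂ : Matrix n n ℝ} (h₁ : A₁.PosDef) (h₂ : A₂.PosDef) {s t : ℝ} (hs : 0 ≤ s)
    (ht : 0 ≤ t) (hst : s + t = 1) (q₁ q₂ : n → ℝ) :
    (s • q₁ + t • q₂) ⬝ᵥ ((s • A₁ + t • A₂)⁻¹ *ᵥ (s • q₁ + t • q₂))
      ≤ s * (q₁ ⬝ᵥ (A₁⁻¹ *ᵥ q₁)) + t * (q₂ ⬝ᵥ (A₂⁻¹ *ᵥ q₂)) := by
  obtain ⟨w, hw⟩ := (h₁.combo h₂ hs ht hst).exists_combo_dotProduct_inv_eq q₁ q₂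
  rw [hw]
  exact add_le_add (mul_le_mul_of_nonneg_left (h₁.two_mul_dotProduct_sub_le _ _) hs)
    (mul_le_mul_of_nonneg_left (h₂.two_mul_dotProduct_sub_le _ _) ht)

theorem Matrix.PosDef.combo_dotProduct_inv_lt {n : Type*} [Fintype n] [DecidableEq n]
    {A : Matrix n n ℝ} (hA : A.PosDef) {s t : ℝ} (hs : 0 < s) (ht : 0 < t) (hst : s + t = 1)
    {q₁ q₂ : n → ℝ} (hq : q₁ ≠ q₂) :
    (s • q₁ + t • q₂) ⬝ᵥ ((s • A + t • A)⁻¹ *ᵥ (s • q₁ + t • q₂))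
      < s * (q₁ ⬝ᵥ (A⁻¹ *ᵥ q₁)) + t * (q₂ ⬝ᵥ (A⁻¹ *ᵥ q₂)) := by
  obtain ⟨w, hw⟩ := (hA.combo hA hs.le ht.le hst).exists_combo_dotProduct_inv_eq q₁ q₂
  rw [hw]
  by_cases h : A *ᵥ w = q₁
  · exact add_lt_add_of_le_of_lt
      (mul_le_mul_of_nonneg_left (hA.two_mul_dotProduct_sub_le _ _) hs.le)
      (mul_lt_mul_of_pos_left (hA.two_mul_dotProduct_sub_lt (h.trans_ne hq)) ht)
  · exact add_lt_add_of_lt_of_le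
      (mul_lt_mul_of_pos_left (hA.two_mul_dotProduct_sub_lt h) hs)
      (mul_le_mul_of_nonneg_left (hA.two_mul_dotProduct_sub_le _ _) ht.le)

theorem combo_dotProduct_self {n : Type*} [Fintype n] {s t : ℝ} (hst : s + t = 1)
    (a b : n → ℝ) :
    (s • a + t • b) ⬝ᵥ (s • a + t • b)
      = s * (a ⬝ᵥ a) + t * (b ⬝ᵥ b) - s * t * ((a - b) ⬝ᵥ (a - b)) := by
  obtain rfl : t = 1 - s := by linarith
  simp only [add_dotProduct, dotProduct_add, smul_dotProduct, dotProduct_smul, smul_eq_mul,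
    sub_dotProduct, dotProduct_sub, dotProduct_comm b a]
  ring

/-- the set `D = {U : 𝒫(h) positive definite}` is convex, and the
entropy `E` is strictly convex on `D`. -/
theorem entropy_strictConvexOn {K : ℕ} (hK : 1 ≤ K) (T : Fin K → Fin K → Fin K → ℝ)
    (hT1 : ∀ k l m, T k l m = T l k m) (hT2 : ∀ k l m, T k l m = T k m l)
    (g : ℝ) (hg : 0 < g) (B : Fin K → ℝ) :
    Convex ℝ {U : StateK K | (Pmat T U.1).PosDef}
      ∧ StrictConvexOn ℝ {U : StateK K | (Pmat T U.1).PosDef} (entropyE T g B) := by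
  have hconv : Convex ℝ {U : StateK K | (Pmat T U.1).PosDef} := by
    intro U hU V hV s t hs ht hst
    simp only [Set.mem_ofPred_eq, Prod.fst_add, Prod.smul_fst, Pmat_combo] at hU hV ⊢
    exact hU.combo hV hs ht hst
  refine ⟨hconv, hconv, ?_⟩
  rintro ⟨h₁, x₁, y₁⟩ hU ⟨h₂, x₂, y₂⟩ hV hne s t hs ht hst
  simp only [Set.mem_ofPred_eq] at hU hV
  simp only [entropyE, Prod.smul_mk, Prod.mk_add_mk, Pmat_combo, smul_eq_mul,
    combo_dotProduct_self hst h₁ h₂, add_dotProduct _ _ B, smul_dotProduct _ _ B]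
  have hx := hU.combo_dotProduct_inv_le hV hs.le ht.le hst x₁ x₂
  have hy := hU.combo_dotProduct_inv_le hV hs.le ht.le hst y₁ y₂
  by_cases hh : h₁ = h₂
  · subst hh
    simp only [sub_self, zero_dotProduct, mul_zero, sub_zero]
    by_cases hxx : x₁ = x₂
    · have hyy : y₁ ≠ y₂ := fun h => hne (by rw [hxx, h])
      linarith [hU.combo_dotProduct_inv_lt hs ht hst hyy]
    · linarith [hU.combo_dotProduct_inv_lt hs ht hst hxx]
  · have hpos : 0 < (h₁ - h₂) ⬝ᵥ (h₁ - h₂) := by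
      simpa using dotProduct_star_self_pos_iff.2 (sub_ne_zero.2 hh)
    have := mul_pos hg (mul_pos (mul_pos hs ht) hpos)
    linarith
end

section
/- Fix g > 0 and B ∈ ℝ^K. For every state U = (h, qˣ, qʸ) with 𝒫(h) invertible, one has V(U)·F(U) − H(U) = ½g uᵀ𝒫(h)h and V(U)·G(U) − K(U) = ½g vᵀ𝒫(h)h; that is, the stochastic energy potentials satisfy Ψ(U) = ½g uᵀ𝒫(h)h and Φ(U) = ½g vᵀ𝒫(h)h. -/
open Matrix

/-- Velocity coefficients `𝒫(h)⁻¹ q`. -/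
noncomputable def uvel {K : ℕ} (T : Fin K → Fin K → Fin K → ℝ) (h q : Fin K → ℝ) :
    Fin K → ℝ :=
  (Pmat T h)⁻¹ *ᵥ q

/-- Dot product on `ℝ^{3K}` realized as triples. -/
noncomputable def tdot {K : ℕ} (a b : StateK K) : ℝ :=
  a.1 ⬝ᵥ b.1 + a.2.1 ⬝ᵥ b.2.1 + a.2.2 ⬝ᵥ b.2.2

/-- The entropy variable `V(U) = (−½𝒫(u)u − ½𝒫(v)v + g(h+B), u, v)`. -/
noncomputable def Vvar {K : ℕ} (T : Fin K → Fin K → Fin K → ℝ) (g : ℝ)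
    (B : Fin K → ℝ) (U : StateK K) : StateK K :=
  (-(1 / 2 : ℝ) • (Pmat T (uvel T U.1 U.2.1) *ᵥ uvel T U.1 U.2.1)
      - (1 / 2 : ℝ) • (Pmat T (uvel T U.1 U.2.2) *ᵥ uvel T U.1 U.2.2)
      + g • (U.1 + B),
   uvel T U.1 U.2.1, uvel T U.1 U.2.2)

/-- The SG flux `F(U) = (qˣ, 𝒫(qˣ)𝒫(h)⁻¹qˣ + ½g𝒫(h)h, 𝒫(qˣ)𝒫(h)⁻¹qʸ)`. -/
noncomputable def Ffl {K : ℕ} (T : Fin K → Fin K → Fin K → ℝ) (g : ℝ)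
    (U : StateK K) : StateK K :=
  (U.2.1,
   Pmat T U.2.1 *ᵥ ((Pmat T U.1)⁻¹ *ᵥ U.2.1) + ((1 / 2) * g) • (Pmat T U.1 *ᵥ U.1),
   Pmat T U.2.1 *ᵥ ((Pmat T U.1)⁻¹ *ᵥ U.2.2))

/-- The SG flux `G(U) = (qʸ, 𝒫(qʸ)𝒫(h)⁻¹qˣ, 𝒫(qʸ)𝒫(h)⁻¹qʸ + ½g𝒫(h)h)`. -/
noncomputable def Gfl {K : ℕ} (T : Fin K → Fin K → Fin K → ℝ) (g : ℝ)
    (U : StateK K) : StateK K :=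
  (U.2.2,
   Pmat T U.2.2 *ᵥ ((Pmat T U.1)⁻¹ *ᵥ U.2.1),
   Pmat T U.2.2 *ᵥ ((Pmat T U.1)⁻¹ *ᵥ U.2.2) + ((1 / 2) * g) • (Pmat T U.1 *ᵥ U.1))

/-- The entropy flux `H(U) = ½(uᵀ𝒫(qˣ)u + vᵀ𝒫(qˣ)v) + g qˣ·(h+B)`. -/
noncomputable def Hflux {K : ℕ} (T : Fin K → Fin K → Fin K → ℝ) (g : ℝ)
    (B : Fin K → ℝ) (U : StateK K) : ℝ :=
  (1 / 2) * (uvel T U.1 U.2.1 ⬝ᵥ (Pmat T U.2.1 *ᵥ uvel T U.1 U.2.1)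
      + uvel T U.1 U.2.2 ⬝ᵥ (Pmat T U.2.1 *ᵥ uvel T U.1 U.2.2))
    + g * (U.2.1 ⬝ᵥ (U.1 + B))

/-- The entropy flux `K(U) = ½(uᵀ𝒫(qʸ)u + vᵀ𝒫(qʸ)v) + g qʸ·(h+B)`. -/
noncomputable def Kflux {K : ℕ} (T : Fin K → Fin K → Fin K → ℝ) (g : ℝ)
    (B : Fin K → ℝ) (U : StateK K) : ℝ :=
  (1 / 2) * (uvel T U.1 U.2.1 ⬝ᵥ (Pmat T U.2.2 *ᵥ uvel T U.1 U.2.1)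
      + uvel T U.1 U.2.2 ⬝ᵥ (Pmat T U.2.2 *ᵥ uvel T U.1 U.2.2))
    + g * (U.2.2 ⬝ᵥ (U.1 + B))

/-- Symmetry of `T` in its first two indices lets the argument of `𝒫` be exchanged with the
vector it is tested against. -/
theorem Pmat_mulVec_dotProduct {K : ℕ} {T : Fin K → Fin K → Fin K → ℝ}
    (hT : ∀ k l m, T k l m = T l k m) (a b c : Fin K → ℝ) :
    (Pmat T a *ᵥ b) ⬝ᵥ c = a ⬝ᵥ (Pmat T c *ᵥ b) := by
  simp only [Pmat, mulVec, dotProduct, of_apply, Finset.sum_mul, Finset.mul_sum]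
  calc _ = ∑ l, ∑ k, ∑ m, a k * T k l m * b m * c l :=
        Finset.sum_congr rfl fun l _ => Finset.sum_comm
    _ = ∑ k, ∑ l, ∑ m, a k * T k l m * b m * c l := Finset.sum_comm
    _ = ∑ k, ∑ m, ∑ l, a k * T k l m * b m * c l :=
        Finset.sum_congr rfl fun k _ => Finset.sum_comm
    _ = _ := by
        refine Finset.sum_congr rfl fun k _ => Finset.sum_congr rfl fun m _ =>
          Finset.sum_congr rfl fun l _ => ?_
        rw [hT k l m]
        ring

/-- the stochastic energy potentials satisfy
`Ψ(U) = V·F − H = ½g uᵀ𝒫(h)h` and `Φ(U) = V·G − K = ½g vᵀ𝒫(h)h`. -/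
theorem energy_potentials {K : ℕ} (hK : 1 ≤ K) (T : Fin K → Fin K → Fin K → ℝ)
    (hT1 : ∀ k l m, T k l m = T l k m) (hT2 : ∀ k l m, T k l m = T k m l)
    (g : ℝ) (hg : 0 < g) (B : Fin K → ℝ) (U : StateK K)
    (hinv : IsUnit (Pmat T U.1)) :
    tdot (Vvar T g B U) (Ffl T g U) - Hflux T g B U
        = (1 / 2) * g * (uvel T U.1 U.2.1 ⬝ᵥ (Pmat T U.1 *ᵥ U.1))
      ∧ tdot (Vvar T g B U) (Gfl T g U) - Kflux T g B U
        = (1 / 2) * g * (uvel T U.1 U.2.2 ⬝ᵥ (Pmat T U.1 *ᵥ U.1)) := by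
  have expand (u v B' q : Fin K → ℝ) :
      (-(1 / 2 : ℝ) • (Pmat T u *ᵥ u) - (1 / 2 : ℝ) • (Pmat T v *ᵥ v) + g • B') ⬝ᵥ q
        = -(1 / 2) * (u ⬝ᵥ (Pmat T q *ᵥ u)) - (1 / 2) * (v ⬝ᵥ (Pmat T q *ᵥ v))
          + g * (q ⬝ᵥ B') := by
    simp only [add_dotProduct, sub_dotProduct, smul_dotProduct, smul_eq_mul,
      Pmat_mulVec_dotProduct hT1, dotProduct_comm B' q]
  constructor
  · simp only [tdot, Vvar, Ffl, Hflux, expand, dotProduct_add, dotProduct_smul, smul_eq_mul,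
      uvel]
    ring
  · simp only [tdot, Vvar, Gfl, Kflux, expand, dotProduct_add, dotProduct_smul, smul_eq_mul,
      uvel]
    ring
end

section
/- Fix g > 0. The SG fluxes F and G are Fréchet differentiable at every state U = (h, qˣ, qʸ) with 𝒫(h) invertible, and their Jacobian matrices are the 3K×3K block matrices J_F(U) = [[0, I, 0], [g𝒫(h) − 𝒫(qˣ)𝒫(h)⁻¹𝒫(u), 𝒫(qˣ)𝒫(h)⁻¹ + 𝒫(u), 0], [−𝒫(qˣ)𝒫(h)⁻¹𝒫(v), 𝒫(v), 𝒫(qˣ)𝒫(h)⁻¹]] and J_G(U) = [[0, 0, I], [−𝒫(qʸ)𝒫(h)⁻¹𝒫(u), 𝒫(qʸ)𝒫(h)⁻¹, 𝒫(u)], [g𝒫(h) − 𝒫(qʸ)𝒫(h)⁻¹𝒫(v), 0, 𝒫(qʸ)𝒫(h)⁻¹ + 𝒫(v)]], where u = 𝒫(h)⁻¹qˣ and v = 𝒫(h)⁻¹qʸ. -/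
open Matrix

/-- The map `a ↦ 𝒫(a)` as a linear map. -/
noncomputable def PmatLin {K : ℕ} (T : Fin K → Fin K → Fin K → ℝ) :
    (Fin K → ℝ) →ₗ[ℝ] Matrix (Fin K) (Fin K) ℝ where
  toFun := Pmat T
  map_add' a b := by
    ext l m
    simp [Pmat, add_mul, Finset.sum_add_distrib]
  map_smul' c a := by
    ext l m
    simp [Pmat, mul_assoc, Finset.mul_sum]

section MatrixCalculus

open scoped Matrix.Norms.Operator

variable {E : Type*} [NormedAddCommGroup E] [NormedSpace ℝ E] {n : Type*} [Fintype n]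

/-- Product rule for a matrix acting on a vector. -/
theorem hasFDerivAt_matrix_mulVec {A : E → Matrix n n ℝ} {w : E → n → ℝ}
    {A' : E →L[ℝ] Matrix n n ℝ} {w' : E →L[ℝ] n → ℝ} {x : E}
    (hA : HasFDerivAt A A' x) (hw : HasFDerivAt w w' x) :
    ∃ L : E →L[ℝ] n → ℝ, HasFDerivAt (fun y => A y *ᵥ w y) L x ∧
      ∀ δ, L δ = A x *ᵥ w' δ + A' δ *ᵥ w x :=
  ⟨_, ((mulVecBilin ℝ ℝ : Matrix n n ℝ →ₗ[ℝ] (n → ℝ) →ₗ[ℝ] n → ℝ).toContinuousBilinearMap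
    ).hasFDerivAt_of_bilinear hA hw, fun _ => rfl⟩

/-- Derivative of the inverse of an invertible matrix. -/
theorem hasFDerivAt_matrix_inv [DecidableEq n] {A : E → Matrix n n ℝ}
    {A' : E →L[ℝ] Matrix n n ℝ} {x : E} (hA : HasFDerivAt A A' x) (hx : IsUnit (A x)) :
    ∃ L : E →L[ℝ] Matrix n n ℝ, HasFDerivAt (fun y => (A y)⁻¹) L x ∧
      ∀ δ, L δ = -((A x)⁻¹ * A' δ * (A x)⁻¹) := by
  obtain ⟨M, hM⟩ := hx
  have hinv := hasFDerivAt_ringInverse (𝕜 := ℝ) M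
  rw [hM] at hinv
  refine ⟨_, (hinv.comp x hA).congr_of_eventuallyEq
    (.of_forall fun y => nonsing_inv_eq_ringInverse (A y)), fun δ => ?_⟩
  rw [← hM, ← coe_units_inv]
  rfl

/-- Derivative of the Galerkin expression `𝒫(a)𝒫(h)⁻¹w` along linear maps `h`, `a`, `w`. -/
theorem hasFDerivAt_Pmat_mulVec_inv_mulVec {K : ℕ} {T : Fin K → Fin K → Fin K → ℝ}
    (hT1 : ∀ k l m, T k l m = T l k m) (hT2 : ∀ k l m, T k l m = T k m l)
    (h a w : E →L[ℝ] Fin K → ℝ) {x : E} (hx : IsUnit (Pmat T (h x))) :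
    ∃ L : E →L[ℝ] Fin K → ℝ,
      HasFDerivAt (fun y => Pmat T (a y) *ᵥ ((Pmat T (h y))⁻¹ *ᵥ w y)) L x ∧
      ∀ δ, L δ = -((Pmat T (a x) * (Pmat T (h x))⁻¹ *
            Pmat T ((Pmat T (h x))⁻¹ *ᵥ w x)) *ᵥ h δ)
          + (Pmat T (a x) * (Pmat T (h x))⁻¹) *ᵥ w δ
          + Pmat T ((Pmat T (h x))⁻¹ *ᵥ w x) *ᵥ a δ := by
  let P := (PmatLin T).toContinuousLinearMap
  obtain ⟨L₁, hL₁, e₁⟩ := hasFDerivAt_matrix_inv (P.comp h).hasFDerivAt hx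
  obtain ⟨L₂, hL₂, e₂⟩ := hasFDerivAt_matrix_mulVec hL₁ w.hasFDerivAt
  obtain ⟨L₃, hL₃, e₃⟩ := hasFDerivAt_matrix_mulVec (P.comp a).hasFDerivAt hL₂
  refine ⟨L₃, hL₃, fun δ => ?_⟩
  have hP (v : E →L[ℝ] Fin K → ℝ) (y : E) : (P.comp v) y = Pmat T (v y) := rfl
  simp only [e₃, e₂, e₁, hP]
  rw [Pmat_mulVec_comm hT1 hT2 (a δ), neg_mulVec, mulVec_add, mulVec_neg, ← mulVec_mulVec,
    ← mulVec_mulVec, Pmat_mulVec_comm hT1 hT2 (h δ)]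
  simp only [mulVec_mulVec, Matrix.mul_assoc]
  abel

/-- Derivative of the hydrostatic pressure term `½g𝒫(h)h`. -/
theorem hasFDerivAt_pressure {K : ℕ} {T : Fin K → Fin K → Fin K → ℝ}
    (hT1 : ∀ k l m, T k l m = T l k m) (hT2 : ∀ k l m, T k l m = T k m l)
    (g : ℝ) (h : E →L[ℝ] Fin K → ℝ) (x : E) :
    ∃ L : E →L[ℝ] Fin K → ℝ,
      HasFDerivAt (fun y => ((1 / 2) * g) • (Pmat T (h y) *ᵥ h y)) L x ∧
      ∀ δ, L δ = (g • Pmat T (h x)) *ᵥ h δ := by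
  let P := (PmatLin T).toContinuousLinearMap
  obtain ⟨L, hL, e⟩ := hasFDerivAt_matrix_mulVec (P.comp h).hasFDerivAt h.hasFDerivAt
  refine ⟨_, hL.const_smul ((1 / 2) * g), fun δ => ?_⟩
  have hP (y : E) : (P.comp h) y = Pmat T (h y) := rfl
  rw [_root_.smul_apply, e, hP, hP, Pmat_mulVec_comm hT1 hT2 (h δ), smul_mulVec]
  module

end MatrixCalculus

/-- the SG fluxes `F` and `G` are Fréchet differentiable at every state
with `𝒫(h)` invertible, with the stated block Jacobians `J_F(U)` and `J_G(U)`. -/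
theorem flux_jacobians {K : ℕ} (hK : 1 ≤ K) (T : Fin K → Fin K → Fin K → ℝ)
    (hT1 : ∀ k l m, T k l m = T l k m) (hT2 : ∀ k l m, T k l m = T k m l)
    (g : ℝ) (hg : 0 < g) (h qx qy : Fin K → ℝ) (hinv : IsUnit (Pmat T h)) :
    let Ph := Pmat T h
    let Pqx := Pmat T qx
    let Pqy := Pmat T qy
    let Pu := Pmat T (Ph⁻¹ *ᵥ qx)
    let Pv := Pmat T (Ph⁻¹ *ᵥ qy)
    (∃ L : StateK K →L[ℝ] StateK K,
      HasFDerivAt (Ffl T g) L (h, qx, qy) ∧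
      ∀ δ : StateK K,
        L δ = (δ.2.1,
               (g • Ph - Pqx * Ph⁻¹ * Pu) *ᵥ δ.1 + (Pqx * Ph⁻¹ + Pu) *ᵥ δ.2.1,
               -((Pqx * Ph⁻¹ * Pv) *ᵥ δ.1) + Pv *ᵥ δ.2.1 + (Pqx * Ph⁻¹) *ᵥ δ.2.2))
    ∧ (∃ L : StateK K →L[ℝ] StateK K,
      HasFDerivAt (Gfl T g) L (h, qx, qy) ∧
      ∀ δ : StateK K,
        L δ = (δ.2.2,
               -((Pqy * Ph⁻¹ * Pu) *ᵥ δ.1) + (Pqy * Ph⁻¹) *ᵥ δ.2.1 + Pu *ᵥ δ.2.2,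
               (g • Ph - Pqy * Ph⁻¹ * Pv) *ᵥ δ.1 + (Pqy * Ph⁻¹ + Pv) *ᵥ δ.2.2)) := by
  intro Ph Pqx Pqy Pu Pv
  let V := Fin K → ℝ
  let πh : StateK K →L[ℝ] V := .fst ℝ V (V × V)
  let πx : StateK K →L[ℝ] V := (ContinuousLinearMap.fst ℝ V V).comp (.snd ℝ V (V × V))
  let πy : StateK K →L[ℝ] V := (ContinuousLinearMap.snd ℝ V V).comp (.snd ℝ V (V × V))
  have key (a w : StateK K →L[ℝ] V) :=
    hasFDerivAt_Pmat_mulVec_inv_mulVec hT1 hT2 πh a w (x := (h, qx, qy)) hinv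
  obtain ⟨Lp, hLp, ep⟩ := hasFDerivAt_pressure hT1 hT2 g πh (h, qx, qy)
  obtain ⟨Lxx, hLxx, exx⟩ := key πx πx
  obtain ⟨Lxy, hLxy, exy⟩ := key πx πy
  obtain ⟨Lyx, hLyx, eyx⟩ := key πy πx
  obtain ⟨Lyy, hLyy, eyy⟩ := key πy πy
  refine ⟨⟨_, πx.hasFDerivAt.prodMk ((hLxx.add hLp).prodMk hLxy), fun δ => ?_⟩,
    ⟨_, πy.hasFDerivAt.prodMk (hLyx.prodMk (hLyy.add hLp)), fun δ => ?_⟩⟩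
  · refine Prod.ext rfl (Prod.ext ?_ ?_)
    · refine (congrArg₂ (· + ·) (exx δ) (ep δ)).trans ?_
      simp only [sub_mulVec, add_mulVec]
      change -((Pqx * Ph⁻¹ * Pu) *ᵥ δ.1) + (Pqx * Ph⁻¹) *ᵥ δ.2.1 + Pu *ᵥ δ.2.1
        + (g • Ph) *ᵥ δ.1 = _
      abel
    · exact (exy δ).trans (add_right_comm _ _ _)
  · refine Prod.ext rfl (Prod.ext ?_ ?_)
    · exact eyx δ
    · refine (congrArg₂ (· + ·) (eyy δ) (ep δ)).trans ?_
      simp only [sub_mulVec, add_mulVec]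
      change -((Pqy * Ph⁻¹ * Pv) *ᵥ δ.1) + (Pqy * Ph⁻¹) *ᵥ δ.2.2 + Pv *ᵥ δ.2.2
        + (g • Ph) *ᵥ δ.1 = _
      abel
end

section
/- Fix g > 0 and Δx, Δy > 0. Consider five cells α ∈ {C, W, E, S, N} with states U_α = (h_α, qˣ_α, qʸ_α), 𝒫(h_α) invertible, and bottoms B_α ∈ ℝ^K. At the four interfaces east = (C,E), west = (W,C), north = (C,N), south = (S,C), suppose the numerical fluxes 𝓕_E, 𝓕_W, 𝓖_N, 𝓖_S ∈ ℝ^{3K} satisfy the sufficient conditions ⟦V⟧·𝓕 = ⟦Ψ⟧ + g⟦B⟧ᵀ𝒫(h̄)ū (for 𝓕_E, 𝓕_W at their interfaces) and ⟦V⟧·𝓖 = ⟦Φ⟧ + g⟦B⟧ᵀ𝒫(h̄)v̄ (for 𝓖_N, 𝓖_S at their interfaces), and define the energy fluxes 𝓗 = V̄·𝓕 − Ψ̄ − (g/4)⟦B⟧ᵀ𝒫(h̄)⟦u⟧ at the east/west interfaces and 𝓚 = V̄·𝓖 − Φ̄ − (g/4)⟦B⟧ᵀ𝒫(h̄)⟦v⟧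 at the north/south interfaces. Then V_C·(−(𝓕_E − 𝓕_W)/Δx − (𝓖_N − 𝓖_S)/Δy + S_C) = −(𝓗_E − 𝓗_W)/Δx − (𝓚_N − 𝓚_S)/Δy, where S_C = (0, −(g/(2Δx))(𝒫(h̄_E)⟦B⟧_E + 𝒫(h̄_W)⟦B⟧_W), −(g/(2Δy))(𝒫(h̄_N)⟦B⟧_N + 𝒫(h̄_S)⟦B⟧_S)). In other words, any fluxes satisfying the sufficient conditions yield an energy-conservative scheme. -/
open Matrix

/-- The interface average `ā = (a_L + a_R)/2`. -/
noncomputable def avg {K : ℕ} (aL aR : Fin K → ℝ) : Fin K → ℝ :=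
  (1 / 2 : ℝ) • (aL + aR)

/-- The energy potential `Ψ(U) = ½g uᵀ𝒫(h)h`. -/
noncomputable def Psi {K : ℕ} (T : Fin K → Fin K → Fin K → ℝ) (g : ℝ)
    (U : StateK K) : ℝ :=
  (1 / 2) * g * (uvel T U.1 U.2.1 ⬝ᵥ (Pmat T U.1 *ᵥ U.1))

/-- The energy potential `Φ(U) = ½g vᵀ𝒫(h)h`. -/
noncomputable def Phi {K : ℕ} (T : Fin K → Fin K → Fin K → ℝ) (g : ℝ)
    (U : StateK K) : ℝ :=
  (1 / 2) * g * (uvel T U.1 U.2.2 ⬝ᵥ (Pmat T U.1 *ᵥ U.1))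

/-- Sufficient energy-conservation condition for an x-direction flux `𝓕` at the
interface with left/right data `(U_L, B_L)`, `(U_R, B_R)`:
`⟦V⟧·𝓕 = ⟦Ψ⟧ + g⟦B⟧ᵀ𝒫(h̄)ū`. -/
def suffCondF {K : ℕ} (T : Fin K → Fin K → Fin K → ℝ) (g : ℝ)
    (BL BR : Fin K → ℝ) (UL UR : StateK K) (F : StateK K) : Prop :=
  tdot (Vvar T g BR UR - Vvar T g BL UL) F
    = Psi T g UR - Psi T g UL
      + g * ((BR - BL) ⬝ᵥ (Pmat T (avg UL.1 UR.1)
          *ᵥ avg (uvel T UL.1 UL.2.1) (uvel T UR.1 UR.2.1)))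

/-- Sufficient energy-conservation condition for a y-direction flux `𝓖`:
`⟦V⟧·𝓖 = ⟦Φ⟧ + g⟦B⟧ᵀ𝒫(h̄)v̄`. -/
def suffCondG {K : ℕ} (T : Fin K → Fin K → Fin K → ℝ) (g : ℝ)
    (BL BR : Fin K → ℝ) (UL UR : StateK K) (G : StateK K) : Prop :=
  tdot (Vvar T g BR UR - Vvar T g BL UL) G
    = Phi T g UR - Phi T g UL
      + g * ((BR - BL) ⬝ᵥ (Pmat T (avg UL.1 UR.1)
          *ᵥ avg (uvel T UL.1 UL.2.2) (uvel T UR.1 UR.2.2)))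

/-- Numerical energy flux `𝓗 = V̄·𝓕 − Ψ̄ − (g/4)⟦B⟧ᵀ𝒫(h̄)⟦u⟧`. -/
noncomputable def Hnum {K : ℕ} (T : Fin K → Fin K → Fin K → ℝ) (g : ℝ)
    (BL BR : Fin K → ℝ) (UL UR : StateK K) (F : StateK K) : ℝ :=
  tdot ((1 / 2 : ℝ) • (Vvar T g BL UL + Vvar T g BR UR)) F
    - (1 / 2) * (Psi T g UL + Psi T g UR)
    - (g / 4) * ((BR - BL) ⬝ᵥ (Pmat T (avg UL.1 UR.1)
        *ᵥ (uvel T UR.1 UR.2.1 - uvel T UL.1 UL.2.1)))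

/-- Numerical energy flux `𝓚 = V̄·𝓖 − Φ̄ − (g/4)⟦B⟧ᵀ𝒫(h̄)⟦v⟧`. -/
noncomputable def Knum {K : ℕ} (T : Fin K → Fin K → Fin K → ℝ) (g : ℝ)
    (BL BR : Fin K → ℝ) (UL UR : StateK K) (G : StateK K) : ℝ :=
  tdot ((1 / 2 : ℝ) • (Vvar T g BL UL + Vvar T g BR UR)) G
    - (1 / 2) * (Phi T g UL + Phi T g UR)
    - (g / 4) * ((BR - BL) ⬝ᵥ (Pmat T (avg UL.1 UR.1)
        *ᵥ (uvel T UR.1 UR.2.2 - uvel T UL.1 UL.2.2)))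

/-- Permutation invariance of `T` makes the bilinear form of `𝒫(a)` symmetric. -/
theorem dotProduct_Pmat_mulVec_comm {K : ℕ} {T : Fin K → Fin K → Fin K → ℝ}
    (hT : ∀ k l m, T k l m = T k m l) (a x y : Fin K → ℝ) :
    x ⬝ᵥ (Pmat T a *ᵥ y) = y ⬝ᵥ (Pmat T a *ᵥ x) := by
  have hsymm : (Pmat T a)ᵀ = Pmat T a := by
    ext l m
    simp only [Pmat, transpose_apply, of_apply]
    exact Finset.sum_congr rfl fun k _ => by rw [hT]
  rw [dotProduct_mulVec, ← mulVec_transpose, hsymm, dotProduct_comm]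

theorem tdot_add_left {K : ℕ} (a b c : StateK K) : tdot (a + b) c = tdot a c + tdot b c := by
  simp only [tdot, Prod.fst_add, Prod.snd_add, add_dotProduct]
  ring

theorem tdot_sub_left {K : ℕ} (a b c : StateK K) : tdot (a - b) c = tdot a c - tdot b c := by
  simp only [tdot, Prod.fst_sub, Prod.snd_sub, sub_dotProduct]
  ring

theorem tdot_smul_left {K : ℕ} (r : ℝ) (a b : StateK K) : tdot (r • a) b = r * tdot a b := by
  simp only [tdot, Prod.smul_fst, Prod.smul_snd, smul_dotProduct, smul_eq_mul]
  ring

theorem tdot_add_right {K : ℕ} (a b c : StateK K) : tdot a (b + c) = tdot a b + tdot a c := by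
  simp only [tdot, Prod.fst_add, Prod.snd_add, dotProduct_add]
  ring

theorem tdot_sub_right {K : ℕ} (a b c : StateK K) : tdot a (b - c) = tdot a b - tdot a c := by
  simp only [tdot, Prod.fst_sub, Prod.snd_sub, dotProduct_sub]
  ring

theorem tdot_smul_right {K : ℕ} (r : ℝ) (a b : StateK K) : tdot a (r • b) = r * tdot a b := by
  simp only [tdot, Prod.smul_fst, Prod.smul_snd, dotProduct_smul, smul_eq_mul]
  ring

section Interface

variable {K : ℕ} {T : Fin K → Fin K → Fin K → ℝ} {g : ℝ} {BL BR : Fin K → ℝ}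
  {UL UR F : StateK K}

/-- Left-cell energy production of an x-direction flux satisfying the sufficient condition. -/
theorem suffCondF.tdot_left (hT : ∀ k l m, T k l m = T k m l)
    (hF : suffCondF T g BL BR UL UR F) :
    tdot (Vvar T g BL UL) F = Hnum T g BL BR UL UR F + Psi T g UL
      - g / 2 * (uvel T UL.1 UL.2.1 ⬝ᵥ (Pmat T (avg UL.1 UR.1) *ᵥ (BR - BL))) := by
  rw [dotProduct_Pmat_mulVec_comm hT]
  simp only [suffCondF, Hnum, tdot_add_left, tdot_sub_left, tdot_smul_left,
    avg, mulVec_add, mulVec_sub, mulVec_smul, dotProduct_add, dotProduct_sub,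
    dotProduct_smul, smul_eq_mul] at hF ⊢
  linear_combination (-1 / 2) * hF

/-- Right-cell energy production of an x-direction flux satisfying the sufficient condition. -/
theorem suffCondF.tdot_right (hT : ∀ k l m, T k l m = T k m l)
    (hF : suffCondF T g BL BR UL UR F) :
    tdot (Vvar T g BR UR) F = Hnum T g BL BR UL UR F + Psi T g UR
      + g / 2 * (uvel T UR.1 UR.2.1 ⬝ᵥ (Pmat T (avg UL.1 UR.1) *ᵥ (BR - BL))) := by
  rw [dotProduct_Pmat_mulVec_comm hT]
  simp only [suffCondF, Hnum, tdot_add_left, tdot_sub_left, tdot_smul_left,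
    avg, mulVec_add, mulVec_sub, mulVec_smul, dotProduct_add, dotProduct_sub,
    dotProduct_smul, smul_eq_mul] at hF ⊢
  linear_combination (1 / 2) * hF

/-- Left-cell energy production of a y-direction flux satisfying the sufficient condition. -/
theorem suffCondG.tdot_left (hT : ∀ k l m, T k l m = T k m l)
    (hG : suffCondG T g BL BR UL UR F) :
    tdot (Vvar T g BL UL) F = Knum T g BL BR UL UR F + Phi T g UL
      - g / 2 * (uvel T UL.1 UL.2.2 ⬝ᵥ (Pmat T (avg UL.1 UR.1) *ᵥ (BR - BL))) := by
  rw [dotProduct_Pmat_mulVec_comm hT]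
  simp only [suffCondG, Knum, tdot_add_left, tdot_sub_left, tdot_smul_left,
    avg, mulVec_add, mulVec_sub, mulVec_smul, dotProduct_add, dotProduct_sub,
    dotProduct_smul, smul_eq_mul] at hG ⊢
  linear_combination (-1 / 2) * hG

/-- Right-cell energy production of a y-direction flux satisfying the sufficient condition. -/
theorem suffCondG.tdot_right (hT : ∀ k l m, T k l m = T k m l)
    (hG : suffCondG T g BL BR UL UR F) :
    tdot (Vvar T g BR UR) F = Knum T g BL BR UL UR F + Phi T g UR
      + g / 2 * (uvel T UR.1 UR.2.2 ⬝ᵥ (Pmat T (avg UL.1 UR.1) *ᵥ (BR - BL))) := by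
  rw [dotProduct_Pmat_mulVec_comm hT]
  simp only [suffCondG, Knum, tdot_add_left, tdot_sub_left, tdot_smul_left,
    avg, mulVec_add, mulVec_sub, mulVec_smul, dotProduct_add, dotProduct_sub,
    dotProduct_smul, smul_eq_mul] at hG ⊢
  linear_combination (1 / 2) * hG

end Interface

/-- any numerical fluxes satisfying the sufficient
energy-conservation conditions yield an energy-conservative scheme: the cell
energy production `V_C·(−(𝓕_E−𝓕_W)/Δx − (𝓖_N−𝓖_S)/Δy + S_C)` equals the
difference of the numerical energy fluxes. -/
theorem ec_scheme_cell_energy_identity {K : ℕ} (hK : 1 ≤ K)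
    (T : Fin K → Fin K → Fin K → ℝ)
    (hT1 : ∀ k l m, T k l m = T l k m) (hT2 : ∀ k l m, T k l m = T k m l)
    (g Δx Δy : ℝ) (hg : 0 < g) (hΔx : 0 < Δx) (hΔy : 0 < Δy)
    (UC UW UE US UN : StateK K) (BC BW BE BS BN : Fin K → ℝ)
    (invC : IsUnit (Pmat T UC.1)) (invW : IsUnit (Pmat T UW.1))
    (invE : IsUnit (Pmat T UE.1)) (invS : IsUnit (Pmat T US.1))
    (invN : IsUnit (Pmat T UN.1))
    (FE FW GN GS : StateK K)
    (hFE : suffCondF T g BC BE UC UE FE)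
    (hFW : suffCondF T g BW BC UW UC FW)
    (hGN : suffCondG T g BC BN UC UN GN)
    (hGS : suffCondG T g BS BC US UC GS) :
    tdot (Vvar T g BC UC)
        (-(1 / Δx) • (FE - FW) - (1 / Δy) • (GN - GS)
          + ((0 : Fin K → ℝ),
             -(g / (2 * Δx)) • (Pmat T (avg UC.1 UE.1) *ᵥ (BE - BC)
                + Pmat T (avg UW.1 UC.1) *ᵥ (BC - BW)),
             -(g / (2 * Δy)) • (Pmat T (avg UC.1 UN.1) *ᵥ (BN - BC)
                + Pmat T (avg US.1 UC.1) *ᵥ (BC - BS))))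
      = -(1 / Δx) * (Hnum T g BC BE UC UE FE - Hnum T g BW BC UW UC FW)
        - (1 / Δy) * (Knum T g BC BN UC UN GN - Knum T g BS BC US UC GS) := by
  have hE := hFE.tdot_left hT2
  have hW := hFW.tdot_right hT2
  have hN := hGN.tdot_left hT2
  have hS := hGS.tdot_right hT2
  simp only [tdot_add_right, tdot_sub_right, tdot_smul_right, hE, hW, hN, hS]
  simp only [tdot, Vvar, dotProduct_zero, dotProduct_smul, dotProduct_add, smul_eq_mul]
  ring
end

section
/- Let n ≥ 1, let R be an invertible real n×n matrix, let D and Π be diagonal real n×n matrices with all diagonal entries nonnegative, and let z ∈ ℝⁿ. If w = (Rᵀ)⁻¹ Π Rᵀ z, then zᵀ (R D Rᵀ) w = Σ_{l=1}^n D_{ll} Π_{ll} ((Rᵀz)_l)² ≥ 0. (This is the key inequality showing that the second-order reconstruction with limited scaled entropy-variable jumps yields an energy stable scheme.) -/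
open Matrix

/-- if `w = (Rᵀ)⁻¹ Π Rᵀ z` with `R` invertible and `D`, `Π` diagonal
with nonnegative entries, then
`zᵀ (R D Rᵀ) w = Σ_l D_{ll} Π_{ll} ((Rᵀ z)_l)² ≥ 0`. -/
theorem limited_jump_dissipation_nonneg {n : ℕ} (hn : 1 ≤ n)
    (R : Matrix (Fin n) (Fin n) ℝ) (hR : IsUnit R)
    (d π : Fin n → ℝ) (hd : ∀ l, 0 ≤ d l) (hπ : ∀ l, 0 ≤ π l)
    (z w : Fin n → ℝ)
    (hw : w = Rᵀ⁻¹ *ᵥ (Matrix.diagonal π *ᵥ (Rᵀ *ᵥ z))) :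
    z ⬝ᵥ ((R * Matrix.diagonal d * Rᵀ) *ᵥ w)
        = ∑ l, d l * π l * ((Rᵀ *ᵥ z) l) ^ 2
      ∧ 0 ≤ z ⬝ᵥ ((R * Matrix.diagonal d * Rᵀ) *ᵥ w) := by
  have hdet : IsUnit Rᵀ.det := by
    rw [Matrix.det_transpose]
    exact (Matrix.isUnit_iff_isUnit_det R).mp hR
  have hRw : Rᵀ *ᵥ w = Matrix.diagonal π *ᵥ (Rᵀ *ᵥ z) := by
    rw [hw, Matrix.mulVec_mulVec, Matrix.mul_nonsing_inv _ hdet, Matrix.one_mulVec]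
  have key : z ⬝ᵥ ((R * Matrix.diagonal d * Rᵀ) *ᵥ w)
      = ∑ l, d l * π l * ((Rᵀ *ᵥ z) l) ^ 2 := by
    rw [← Matrix.mulVec_mulVec, hRw, ← Matrix.mulVec_mulVec, Matrix.dotProduct_mulVec,
      ← Matrix.mulVec_transpose]
    simp only [dotProduct, Matrix.mulVec_diagonal]
    exact Finset.sum_congr rfl fun l _ => by ring
  refine ⟨key, key ▸ Finset.sum_nonneg fun l _ => ?_⟩
  exact mul_nonneg (mul_nonneg (hd l) (hπ l)) (sq_nonneg _)
end
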